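/- arXiv:2512.15490 — 4 statements merged into one kernel-verified Lean document; each statement's English description precedes it below -/
import Mathlib

section
/- A set X ⊆ 2^ω is universally meager if and only if for every Polish space Y and every continuous nowhere constant map f : Y → 2^ω, the preimage f⁻¹[X] is meager in Y. -/
/-- A map is *nowhere constant* if it is not constant on any nonempty open set. -/
def NowhereConstant {Y Z : Type*} [TopologicalSpace Y] (f : Y → Z) : Prop :=
  ∀ U : Set Y, IsOpen U → U.Nonempty → ∃ x ∈ U, ∃ y ∈ U, f x ≠ f y

/-- A set `X ⊆ 2^ω` is *universally meager* if for every injective Borel-measurable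
map `f : 2^ω → 2^ω` the image `f '' X` is meager in `2^ω`. -/
def UniversallyMeager (X : Set (ℕ → Bool)) : Prop :=
  ∀ f : (ℕ → Bool) → (ℕ → Bool), Function.Injective f → Measurable f →
    IsMeagre (f '' X)

open Set Filter Topology Function PiNat

section Polish

variable {α β : Type*} [TopologicalSpace α]

theorem polishSpace_iInter_of_isOpen {ι : Type*} [Countable ι] [PolishSpace α] {U : ι → Set α}
    (hU : ∀ i, IsOpen (U i)) : PolishSpace (⋂ i, U i : Set α) := by
  have := fun i => (hU i).polishSpace
  let e : (⋂ i, U i : Set α) → α × (∀ i, U i) := fun y => (y, fun i => ⟨y, mem_iInter.1 y.2 i⟩)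
  have he : Continuous e := by fun_prop
  have hemb : IsEmbedding e :=
    .of_comp he continuous_fst (IsEmbedding.subtypeVal (p := (· ∈ ⋂ i, U i)))
  have hrange : range e = ⋂ i, {p : α × (∀ i, U i) | p.1 = p.2 i} := by
    ext p
    simp only [mem_iInter, mem_ofPred_eq]
    constructor
    · rintro ⟨y, rfl⟩ i
      rfl
    · intro hp
      refine ⟨⟨p.1, mem_iInter.2 fun i => hp i ▸ (p.2 i).2⟩, ?_⟩
      exact Prod.ext rfl (funext fun i => Subtype.ext (hp i))
  have hclosed : IsClosed (range e) := by
    rw [hrange]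
    exact isClosed_iInter fun i => isClosed_eq continuous_fst (by fun_prop)
  exact IsClosedEmbedding.polishSpace ⟨hemb, hclosed⟩

theorem IsGδ.polishSpace [PolishSpace α] {s : Set α} (hs : IsGδ s) : PolishSpace s := by
  obtain ⟨T, hT, hTc, rfl⟩ := hs
  have := hTc.to_subtype
  rw [sInter_eq_iInter]
  exact polishSpace_iInter_of_isOpen fun t : T => hT t t.2

/-- A Borel measurable map to a second countable space is continuous on a comeager set. -/
theorem Measurable.exists_mem_residual_continuousOn [MeasurableSpace α] [BorelSpace α]
    [TopologicalSpace β] [SecondCountableTopology β] [MeasurableSpace β] [OpensMeasurableSpace β]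
    {g : α → β} (hg : Measurable g) : ∃ R ∈ residual α, ContinuousOn g R := by
  have hB := TopologicalSpace.isBasis_countableBasis β
  choose! u huo hu using fun (b : Set β) (hb : b ∈ TopologicalSpace.countableBasis β) =>
    (hg (hB.isOpen hb).measurableSet).residualEq_isOpen
  refine ⟨{x | ∀ b ∈ TopologicalSpace.countableBasis β, x ∈ g ⁻¹' b ↔ x ∈ u b}, ?_, ?_⟩
  · exact (eventually_countable_ball (TopologicalSpace.countable_countableBasis β)).2
      fun b hb => (hu b hb).mem_iff
  · intro x hx
    refine (hB.nhds_hasBasis).tendsto_right_iff.2 fun b ⟨hb, hxb⟩ => ?_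
    filter_upwards [self_mem_nhdsWithin,
      mem_nhdsWithin_of_mem_nhds ((huo b hb).mem_nhds ((hx b hb).1 hxb))] with y hy hyu
    exact (hy b hb).2 hyu

end Polish

section Cylinder

instance polishSpace_nat_bool : PolishSpace (ℕ → Bool) :=
  have : PolishSpace Bool := inferInstance
  inferInstance

theorem IsOpen.exists_cylinder_subset {A : Set (ℕ → Bool)} (hA : IsOpen A) {x : ℕ → Bool}
    (hx : x ∈ A) : ∃ n, cylinder x n ⊆ A := by
  obtain ⟨_, ⟨y, n, rfl⟩, hxy, hyA⟩ :=
    (isTopologicalBasis_cylinders fun _ : ℕ => Bool).exists_subset_of_mem_open hx hA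
  exact ⟨n, (mem_cylinder_iff_eq.1 hxy).trans_subset hyA⟩

theorem IsOpen.diff_singleton_nonempty {A : Set (ℕ → Bool)} (hA : IsOpen A) {x : ℕ → Bool}
    (hx : x ∈ A) : (A \ {x}).Nonempty := by
  obtain ⟨n, hn⟩ := hA.exists_cylinder_subset hx
  refine ⟨update x n (!x n), hn (update_mem_cylinder x n _), fun h => ?_⟩
  simpa using congrFun (mem_singleton_iff.1 h) n

end Cylinder

theorem UniversallyMeager.of_preimage {X : Set (ℕ → Bool)}
    (H : ∀ (Y : Type) [TopologicalSpace Y] [PolishSpace Y] (f : Y → (ℕ → Bool)),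
      Continuous f → NowhereConstant f → IsMeagre (f ⁻¹' X)) : UniversallyMeager X := by
  intro f hf hfm
  have hfe := hfm.measurableEmbedding hf
  obtain ⟨g, hg, hgf⟩ := hfe.exists_measurable_extend measurable_id fun x => ⟨x⟩
  have hgf : ∀ x, g (f x) = x := congrFun hgf
  obtain ⟨R, hR, hgR⟩ := hg.exists_mem_residual_continuousOn
  obtain ⟨U, hU, hBU⟩ := hfe.measurableSet_range.residualEq_isOpen
  obtain ⟨G, hGR, hG, hGd⟩ := mem_residual.1 (inter_mem hR hBU.mem_iff)
  have hGU : ∀ x ∈ G, x ∈ U → x ∈ range f := fun x hx => (hGR hx).2.2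
  have := (hG.inter hU.isGδ).polishSpace
  have hcont : Continuous ((G ∩ U).domRestrict g) :=
    continuousOn_iff_continuous_domRestrict.1 (hgR.mono fun x hx => (hGR hx.1).1)
  have hnc : NowhereConstant ((G ∩ U).domRestrict g) := by
    rintro _ ⟨O, hO, rfl⟩ ⟨x, hx⟩
    have hOU := hO.inter hU
    obtain ⟨y, hy, hyG⟩ := hGd.inter_open_nonempty _ (hOU.sdiff isClosed_singleton)
      (hOU.diff_singleton_nonempty ⟨hx, x.2.2⟩)
    refine ⟨x, hx, ⟨y, hyG, hy.1.2⟩, hy.1.1, fun h => hy.2 ?_⟩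
    obtain ⟨a, ha⟩ := hGU _ x.2.1 x.2.2
    obtain ⟨b, rfl⟩ := hGU _ hyG hy.1.2
    simp only [domRestrict_apply, ← ha, hgf] at h
    simp [← ha, h]
  have hm := (H _ _ hcont hnc).image_val
  have hGm : IsMeagre Gᶜ := by
    rw [IsMeagre, compl_compl]
    exact residual_of_dense_Gδ hG hGd
  refine (hm.union hGm).mono ?_
  rintro _ ⟨x, hx, rfl⟩
  by_cases hxG : f x ∈ G
  · refine .inl ⟨⟨f x, hxG, (hGR hxG).2.1 ⟨x, rfl⟩⟩, ?_, rfl⟩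
    simpa [hgf] using hx
  · exact .inr hxG

section Collapse

/-- `n` is a *branching level* of `K` along `w` if two points of `K` that agree with `w` below `n`
disagree at `n`. -/
def BranchesAt (K : Set (ℕ → Bool)) (w : ℕ → Bool) (n : ℕ) : Prop :=
  ∃ u ∈ K, ∃ v ∈ K, u ∈ cylinder w n ∧ v ∈ cylinder w n ∧ u n ≠ v n

/-- The map that keeps, of each sequence, only the entries at the branching levels of `K`. -/
noncomputable def collapse (K : Set (ℕ → Bool)) (w : ℕ → Bool) (k : ℕ) : Bool :=
  w (Nat.nth (BranchesAt K w) k)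

variable {K : Set (ℕ → Bool)} {w v : ℕ → Bool} {n p k : ℕ}

theorem BranchesAt.congr (h : v ∈ cylinder w n) (hp : p ≤ n) :
    BranchesAt K v p ↔ BranchesAt K w p := by
  have : cylinder v p = cylinder w p := mem_cylinder_iff_eq.1 (cylinder_anti w hp h)
  simp only [BranchesAt, this]

theorem BranchesAt.of_mem (hw : w ∈ K) (hv : v ∈ K) (h : v ∈ cylinder w p) (hne : v p ≠ w p) :
    BranchesAt K w p :=
  ⟨v, hv, w, hw, h, self_mem_cylinder w p, hne⟩

/-- `K` has no isolated points. -/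
def CylinderPerfect (K : Set (ℕ → Bool)) : Prop :=
  ∀ w ∈ K, ∀ n, ∃ v ∈ K, v ∈ cylinder w n ∧ v ≠ w

theorem CylinderPerfect.infinite_branchesAt (hK : CylinderPerfect K) (hw : w ∈ K) :
    (Set.ofPred (BranchesAt K w)).Infinite := by
  refine infinite_of_forall_exists_gt fun n => ?_
  obtain ⟨v, hv, hvn, hne⟩ := hK w hw (n + 1)
  exact ⟨firstDiff v w, .of_mem hw hv (mem_cylinder_firstDiff v w) (apply_firstDiff_ne hne),
    (mem_cylinder_iff_le_firstDiff hne _).1 hvn⟩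

open Classical in
theorem BranchesAt.count_congr (h : v ∈ cylinder w n) :
    Nat.count (BranchesAt K v) n = Nat.count (BranchesAt K w) n :=
  le_antisymm (Nat.count_mono_left fun _ hk => (BranchesAt.congr h hk.le).1)
    (Nat.count_mono_left fun _ hk => (BranchesAt.congr h hk.le).2)

open Classical in
theorem collapse_count (h : BranchesAt K w p) :
    collapse K w (Nat.count (BranchesAt K w) p) = w p := by
  rw [collapse, Nat.nth_count h]

open Classical in
theorem CylinderPerfect.exists_branchesAt (hK : CylinderPerfect K) (hw : w ∈ K) (k : ℕ) :
    ∃ p, BranchesAt K w p ∧ Nat.count (BranchesAt K w) p = k :=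
  ⟨_, Nat.nth_mem_of_infinite (hK.infinite_branchesAt hw) k,
    Nat.count_nth_of_infinite (hK.infinite_branchesAt hw) k⟩

open Classical in
theorem collapse_eq_of_mem_cylinder (hp : BranchesAt K w p) (h : v ∈ cylinder w p) :
    collapse K v (Nat.count (BranchesAt K w) p) = v p := by
  rw [← BranchesAt.count_congr h]
  exact collapse_count ((BranchesAt.congr h le_rfl).2 hp)

theorem injOn_collapse : InjOn (collapse K) K := by
  intro w hw v hv h
  by_contra hne
  have hb := BranchesAt.of_mem hv hw (mem_cylinder_firstDiff w v) (apply_firstDiff_ne hne)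
  have h₁ := collapse_eq_of_mem_cylinder hb (mem_cylinder_firstDiff w v)
  rw [h, collapse_count hb] at h₁
  exact apply_firstDiff_ne hne h₁.symm

open Classical in
theorem collapse_eq_of_lt_count (h : v ∈ cylinder w n) (hk : k < Nat.count (BranchesAt K w) n) :
    collapse K v k = collapse K w k := by
  have hp : BranchesAt K w (Nat.nth (BranchesAt K w) k) :=
    Nat.nth_mem k fun hf => hk.trans_le (Nat.count_le_card hf n)
  have hpn := Nat.nth_lt_of_lt_count hk
  have hc : Nat.count (BranchesAt K w) (Nat.nth (BranchesAt K w) k) = k :=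
    Nat.count_nth fun hf => hk.trans_le (Nat.count_le_card hf n)
  have h₁ := collapse_eq_of_mem_cylinder hp (cylinder_anti w hpn.le h)
  rw [hc] at h₁
  rw [h₁, collapse]
  exact h _ hpn

open Classical in
theorem CylinderPerfect.continuousOn_collapse (hK : CylinderPerfect K) :
    ContinuousOn (collapse K) K := by
  refine continuousOn_pi.2 fun k w hw => ?_
  obtain ⟨p, hp, rfl⟩ := hK.exists_branchesAt hw k
  refine (continuousWithinAt_const (b := w p)).congr_of_eventuallyEq ?_ (collapse_count hp)
  filter_upwards [mem_nhdsWithin_of_mem_nhds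
    ((isOpen_cylinder _ w (p + 1)).mem_nhds (self_mem_cylinder w _))] with v hv
  rw [collapse_eq_of_mem_cylinder hp (cylinder_anti w p.le_succ hv)]
  exact hv p p.lt_succ_self

open Classical in
/-- The image under `collapse K` of a relatively open subset of `K` is somewhere dense. -/
theorem CylinderPerfect.exists_collapse_mem_cylinder (hK : CylinderPerfect K) (hw : w ∈ K) (n : ℕ)
    (hv : v ∈ cylinder (collapse K w) (Nat.count (BranchesAt K w) n)) (k : ℕ) :
    ∃ u ∈ K, u ∈ cylinder w n ∧ collapse K u ∈ cylinder v k := by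
  induction k with
  | zero => exact ⟨w, hw, self_mem_cylinder w n, by simp⟩
  | succ k ih =>
    obtain ⟨u, hu, hun, huk⟩ := ih
    obtain hk | hk := lt_or_ge k (Nat.count (BranchesAt K w) n)
    · refine ⟨u, hu, hun, fun j hj => ?_⟩
      obtain hj | rfl := Nat.lt_succ_iff_lt_or_eq.1 hj
      · exact huk j hj
      · rw [collapse_eq_of_lt_count hun hk, hv j hk]
    · obtain ⟨p, hp, hpk⟩ := hK.exists_branchesAt hu k
      have hnp : n ≤ p := by
        by_contra! hpn
        have := Nat.count_strict_mono hp hpn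
        rw [BranchesAt.count_congr hun] at this
        omega
      obtain ⟨u', hu', hu'p, hu'v⟩ : ∃ u' ∈ K, u' ∈ cylinder u p ∧ u' p = v k := by
        obtain ⟨a, ha, b, hb, hau, hbu, hab⟩ := hp
        by_cases h : a p = v k
        · exact ⟨a, ha, hau, h⟩
        · refine ⟨b, hb, hbu, ?_⟩
          cases ha' : a p <;> cases hb' : b p <;> cases hv' : v k <;> simp_all
      have hcyl : cylinder u n = cylinder w n := mem_cylinder_iff_eq.1 hun
      refine ⟨u', hu', hcyl ▸ cylinder_anti u hnp hu'p, fun j hj => ?_⟩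
      obtain hj | rfl := Nat.lt_succ_iff_lt_or_eq.1 hj
      · rw [collapse_eq_of_lt_count hu'p (hpk ▸ hj), huk j hj]
      · rw [← hpk, collapse_eq_of_mem_cylinder hp hu'p, hu'v, hpk]

theorem CylinderPerfect.exists_collapse_mem (hK : CylinderPerfect K) (hw : w ∈ K) (n : ℕ)
    {A : Set (ℕ → Bool)} (hA : IsOpen A) (hAd : Dense A) :
    ∃ u ∈ K, u ∈ cylinder w n ∧ collapse K u ∈ A := by
  classical
  obtain ⟨v, hv, hvA⟩ := hAd.inter_open_nonempty _
    (isOpen_cylinder _ (collapse K w) (Nat.count (BranchesAt K w) n)) ⟨_, self_mem_cylinder _ _⟩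
  obtain ⟨k, hk⟩ := hA.exists_cylinder_subset hvA
  obtain ⟨u, hu, hun, huk⟩ := hK.exists_collapse_mem_cylinder hw n hv k
  exact ⟨u, hu, hun, hk huk⟩

end Collapse

section Filter

variable {G : Filter (ℕ → Bool)}

/-- The set of points all of whose neighborhoods are positive for the filter `G`. -/
def positiveSupport (G : Filter (ℕ → Bool)) : Set (ℕ → Bool) :=
  {w | ∀ n, ∃ᶠ v in G, v ∈ cylinder w n}

theorem isClosed_positiveSupport : IsClosed (positiveSupport G) := by
  rw [← isOpen_compl_iff, isOpen_iff_mem_nhds]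
  intro w hw
  simp only [positiveSupport, mem_compl_iff, mem_ofPred_eq, not_forall] at hw
  obtain ⟨n, hn⟩ := hw
  refine mem_of_superset ((isOpen_cylinder _ w n).mem_nhds (self_mem_cylinder w n)) ?_
  intro v hv hvK
  exact hn (mem_cylinder_iff_eq.1 hv ▸ hvK n)

theorem positiveSupport_mem [CountableInterFilter G] : positiveSupport G ∈ G := by
  have h : ∀ p : ℕ × List Bool, ∀ᶠ v in G,
      (∀ᶠ u in G, res u p.1 ≠ p.2) → res v p.1 ≠ p.2 := fun p => by
    by_cases hp : ∀ᶠ u in G, res u p.1 ≠ p.2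
    · filter_upwards [hp] with v hv _ using hv
    · exact .of_forall fun v h => absurd h hp
  filter_upwards [eventually_countable_forall.2 h] with w hw n
  have := mt (hw (n, res w n)) (by simp)
  simpa only [cylinder_eq_res, Filter.Frequently, mem_ofPred_eq] using this

theorem cylinderPerfect_positiveSupport [CountableInterFilter G]
    (hG : ∀ w, ∀ᶠ v in G, v ≠ w) : CylinderPerfect (positiveSupport G) := fun w hw n =>
  have ⟨v, ⟨hvn, hvK⟩, hvw⟩ :=
    (((hw n).and_eventually positiveSupport_mem).and_eventually (hG w)).exists
  ⟨v, hvK, hvn, hvw⟩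

theorem exists_measurable_injOn_tendsto_residual [CountableInterFilter G]
    (hG : ∀ w, ∀ᶠ v in G, v ≠ w)
    (hdense : ∀ C, MeasurableSet C → (∃ᶠ w in G, w ∈ C) →
      ∃ n, (∃ᶠ w in G, w n = true) ∧ ∀ᶠ w in G, w n = true → w ∈ C) :
    ∃ e : (ℕ → Bool) → (ℕ → Bool), Measurable e ∧ Tendsto e G (residual _) ∧
      ∃ N ∈ G, MeasurableSet N ∧ InjOn e N := by
  classical
  set K := positiveSupport G with hKdef
  have hK : CylinderPerfect K := cylinderPerfect_positiveSupport hG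
  have hKG : K ∈ G := positiveSupport_mem
  have hKm : MeasurableSet K := isClosed_positiveSupport.measurableSet
  set e := K.piecewise (collapse K) (fun _ _ => false)
  have heK : EqOn e (collapse K) K := piecewise_eqOn _ _ _
  have hem : Measurable e :=
    hK.continuousOn_collapse.measurable_piecewise continuousOn_const hKm
  refine ⟨e, hem, ?_, K, hKG, hKm, heK.injOn_iff.2 injOn_collapse⟩
  refine le_countableGenerate_iff_of_countableInterFilter.2 ?_
  rintro A ⟨hA, hAd⟩
  by_contra hAG
  obtain ⟨n, hn, hnA⟩ := hdense (e ⁻¹' A)ᶜ (hem hA.measurableSet).compl (not_eventually.1 hAG)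
  obtain ⟨w, hwn, hw⟩ := (hn.and_eventually hKG).exists
  obtain ⟨u, hu, huw, huA⟩ := hK.exists_collapse_mem hw (n + 1) hA hAd
  obtain ⟨O, hO, hOA⟩ := continuousOn_iff'.1 hK.continuousOn_collapse A hA
  obtain ⟨l, hl⟩ := hO.exists_cylinder_subset (hOA.subset ⟨huA, hu⟩).1
  obtain ⟨v, ⟨hvl, hvK⟩, hvA⟩ :=
    (((hu (max l (n + 1))).and_eventually hKG).and_eventually hnA).exists
  have hvn : v n = true := by
    rw [hvl n (by omega), huw n n.lt_succ_self, hwn]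
  refine hvA hvn ?_
  rw [mem_preimage, heK hvK]
  exact (hOA.symm.subset ⟨hl (cylinder_anti u (le_max_left _ _) hvl), hvK⟩).1

/-- Interleaves a sequence with the constant sequence `false`. -/
def sparse (x : ℕ → Bool) (n : ℕ) : Bool :=
  if Even n then x (n / 2) else false

theorem injective_sparse : Injective sparse := fun x y h =>
  funext fun n => by simpa [sparse] using congrFun h (2 * n)

theorem continuous_sparse : Continuous sparse := by
  refine continuous_pi fun n => ?_
  unfold sparse
  split_ifs
  · exact continuous_apply _
  · exact continuous_const

theorem compl_range_sparse_mem_residual : (range sparse)ᶜ ∈ residual (ℕ → Bool) := by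
  refine residual_of_dense_open (isCompact_range continuous_sparse).isClosed.isOpen_compl ?_
  refine dense_iff_inter_open.2 fun O hO ⟨x, hx⟩ => ?_
  obtain ⟨n, hn⟩ := hO.exists_cylinder_subset hx
  refine ⟨update x (2 * n + 1) true,
    hn (cylinder_anti x (by omega) (update_mem_cylinder x (2 * n + 1) _)), ?_⟩
  rintro ⟨y, hy⟩
  simpa [sparse] using congrFun hy (2 * n + 1)

theorem exists_measurable_injective_tendsto_residual [CountableInterFilter G]
    (hG : ∀ w, ∀ᶠ v in G, v ≠ w)
    (hdense : ∀ C, MeasurableSet C → (∃ᶠ w in G, w ∈ C) →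
      ∃ n, (∃ᶠ w in G, w n = true) ∧ ∀ᶠ w in G, w n = true → w ∈ C) :
    ∃ e : (ℕ → Bool) → (ℕ → Bool), Measurable e ∧ Injective e ∧ Tendsto e G (residual _) := by
  classical
  obtain ⟨e, hem, he, N, hNG, hN, hinj⟩ := exists_measurable_injOn_tendsto_residual hG hdense
  have hrange : MeasurableSet (range sparse) :=
    (isCompact_range continuous_sparse).isClosed.measurableSet
  set M := N ∩ e ⁻¹' (range sparse)ᶜ
  have hMG : M ∈ G := inter_mem hNG (he compl_range_sparse_mem_residual)
  have hM : MeasurableSet M := hN.inter (hem hrange.compl)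
  refine ⟨M.piecewise e sparse, hem.piecewise hM continuous_sparse.measurable, ?_, ?_⟩
  · refine (injective_piecewise_iff _).2
      ⟨hinj.mono inter_subset_left, injective_sparse.injOn, fun x hx y _ h => hx.2 ⟨y, h.symm⟩⟩
  · exact he.congr' (mem_of_superset hMG fun x hx => (piecewise_eq_of_mem _ _ _ hx).symm)

end Filter

section Hull

variable {Y Z : Type*} [TopologicalSpace Y] [MeasurableSpace Z]

/-- Among the measurable sets whose preimage under `f` is almost disjoint from `s`, there is a
largest one modulo sets with meager preimage. -/
theorem exists_largest_measurableSet_almost_disjoint [SecondCountableTopology Y]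
    [MeasurableSpace Y] [BorelSpace Y] {f : Y → Z} (hf : Measurable f) (s : Set Y) :
    ∃ D, MeasurableSet D ∧ (∀ᶠ y in residual Y, y ∈ s → f y ∉ D) ∧
      ∀ C, MeasurableSet C → (∀ᶠ y in residual Y, y ∈ s → f y ∉ C) →
        ∀ᶠ y in residual Y, f y ∈ C → f y ∈ D := by
  choose! W hWo hW using fun (C : Set Z) (hC : MeasurableSet C) => (hf hC).residualEq_isOpen
  obtain ⟨T, hT, hTc, hTW⟩ := TopologicalSpace.isOpen_biUnion_countable
    {C : Set Z | MeasurableSet C ∧ ∀ᶠ y in residual Y, y ∈ s → f y ∉ C} W fun C hC => hWo C hC.1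
  refine ⟨⋃₀ T, .sUnion hTc fun C hC => (hT hC).1, ?_, fun C hC hCs => ?_⟩
  · filter_upwards [(eventually_countable_ball hTc).2 fun C hC => (hT hC).2] with y hy hys hyT
    obtain ⟨C, hC, hyC⟩ := hyT
    exact hy C hC hys hyC
  · filter_upwards [(hW C hC).mem_iff,
      (eventually_countable_ball hTc).2 fun C hC => (hW C (hT hC).1).mem_iff] with y hyC hyT hy
    obtain ⟨C', hC', hyC'⟩ := mem_iUnion₂.1 (hTW.symm.subset
      (mem_iUnion₂.2 ⟨C, ⟨hC, hCs⟩, hyC.1 hy⟩))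
    exact ⟨C', hC', (hyT C' hC').2 hyC'⟩

end Hull

theorem UniversallyMeager.isMeagre_preimage {X : Set (ℕ → Bool)} (hX : UniversallyMeager X)
    {Y : Type*} [TopologicalSpace Y] [PolishSpace Y] {f : Y → (ℕ → Bool)} (hf : Continuous f)
    (hnc : NowhereConstant f) : IsMeagre (f ⁻¹' X) := by
  classical
  borelize Y
  obtain ⟨U, hU⟩ := countable_iff_exists_subset_range.1 (TopologicalSpace.countable_countableBasis Y)
  choose D hDm hUD hD using fun n =>
    exists_largest_measurableSet_almost_disjoint hf.measurable (U n)
  let P : ℕ → Set (ℕ → Bool) := fun k => if Even k then {z | z (k / 2) = true} else (D (k / 2))ᶜ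
  have hPm : ∀ k, MeasurableSet (P k) := fun k => by
    simp only [P]
    split_ifs
    · have hk : Measurable fun z : ℕ → Bool => z (k / 2) := measurable_pi_apply _
      exact hk (measurableSet_singleton true)
    · exact (hDm _).compl
  let Φ : (ℕ → Bool) → (ℕ → Bool) := fun z k => decide (z ∈ P k)
  have hΦ : ∀ z k, Φ z k = true ↔ z ∈ P k := fun z k => decide_eq_true_iff
  have hΦm : Measurable Φ :=
    measurable_pi_iff.2 fun k => by
      refine measurable_to_bool ?_
      simpa only [preimage, mem_singleton_iff, hΦ, ofPred_mem_eq] using hPm k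
  have heven : ∀ z n, Φ z (2 * n) = true ↔ z n = true := fun z n => by
    rw [hΦ]
    have h₁ : Even (2 * n) := by simp
    have h₂ : 2 * n / 2 = n := by omega
    simp only [P, if_pos h₁, h₂, mem_ofPred_eq]
  have hodd : ∀ z n, Φ z (2 * n + 1) = true ↔ z ∉ D n := fun z n => by
    rw [hΦ]
    have h₁ : ¬Even (2 * n + 1) := by simp
    have h₂ : (2 * n + 1) / 2 = n := by omega
    simp only [P, if_neg h₁, h₂, mem_compl_iff]
  have hΦi : Injective Φ := fun x y h => funext fun n =>
    Bool.eq_iff_iff.2 (by rw [← heven x n, ← heven y n, h])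
  have hfiber : ∀ w, ∀ᶠ v in map (Φ ∘ f) (residual Y), v ≠ w := by
    intro w
    rw [eventually_map]
    by_cases hw : ∃ y, Φ (f y) = w
    · obtain ⟨y, rfl⟩ := hw
      have hopen : IsOpen (f ⁻¹' {f y}ᶜ) := hf.isOpen_preimage _ isOpen_compl_singleton
      refine mem_of_superset (residual_of_dense_open hopen ?_) fun z hz h => hz (hΦi h)
      refine dense_iff_inter_open.2 fun V hV hVne => ?_
      obtain ⟨a, ha, b, hb, hab⟩ := hnc V hV hVne
      by_cases h : f a = f y
      · exact ⟨b, hb, fun h' => hab (h.trans (Eq.symm h'))⟩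
      · exact ⟨a, ha, h⟩
    · exact .of_forall fun y hy => hw ⟨y, hy⟩
  have hdense : ∀ C, MeasurableSet C → (∃ᶠ w in map (Φ ∘ f) (residual Y), w ∈ C) →
      ∃ n, (∃ᶠ w in map (Φ ∘ f) (residual Y), w n = true) ∧
        ∀ᶠ w in map (Φ ∘ f) (residual Y), w n = true → w ∈ C := by
    intro C hC hCG
    have hpre : MeasurableSet (Φ ⁻¹' C) := hΦm hC
    obtain ⟨W, hW, hCW⟩ := (hf.measurable hpre).residualEq_isOpen
    obtain ⟨y, hyC, hy⟩ := ((frequently_map.1 hCG).and_eventually hCW.mem_iff).exists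
    obtain ⟨V, hVb, -, hVW⟩ := (TopologicalSpace.isBasis_countableBasis Y).exists_subset_of_mem_open
      (hy.1 hyC) hW
    obtain ⟨n, rfl⟩ := hU hVb
    refine ⟨2 * n + 1, ?_, ?_⟩
    · rw [frequently_map]
      intro hn
      refine not_isMeagre_of_isOpen (TopologicalSpace.isOpen_of_mem_countableBasis hVb)
        (TopologicalSpace.nonempty_of_mem_countableBasis hVb) ?_
      filter_upwards [hn, hUD n] with z hz hzD hzU
      exact hz ((hodd _ _).2 (hzD hzU))
    · rw [eventually_map]
      filter_upwards [hD n (Φ ⁻¹' C)ᶜ hpre.compl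
        (hCW.mem_iff.mono fun z hz hzU => not_not.2 (hz.2 (hVW hzU)))] with z hz hzD
      by_contra hzC
      exact (hodd _ _).1 hzD (hz hzC)
  obtain ⟨e, hem, hei, he⟩ := exists_measurable_injective_tendsto_residual hfiber hdense
  have hmem := he (hX (e ∘ Φ) (hei.comp hΦi) (hem.comp hΦm))
  exact mem_of_superset hmem fun y hy hyX => hy ⟨f y, hyX, rfl⟩

/-- A set `X ⊆ 2^ω` is universally meager if and only if for every Polish space `Y`
and every continuous nowhere constant map `f : Y → 2^ω`, the preimage `f ⁻¹' X`
is meager in `Y`. -/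
theorem universallyMeager_iff_preimage_meager (X : Set (ℕ → Bool)) :
    UniversallyMeager X ↔
      ∀ (Y : Type) [TopologicalSpace Y] [PolishSpace Y] (f : Y → (ℕ → Bool)),
        Continuous f → NowhereConstant f → IsMeagre (f ⁻¹' X) :=
  ⟨fun hX _ _ _ _ hf hnc => hX.isMeagre_preimage hf hnc, UniversallyMeager.of_preimage⟩
end

section
/- Assume that every strong measure zero subset of 2^ω is meager in 2^ω. Then every strong measure zero subset of 2^ω is perfectly meager. -/
/-- The standard metric on the Cantor space `2^ω`:
`dist x y = 2^{-min{n : x n ≠ y n}}` for `x ≠ y`. -/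
noncomputable instance : MetricSpace (ℕ → Bool) := PiNat.metricSpace

/-- A set `X ⊆ 2^ω` has *strong measure zero* if for every sequence of positive
reals `⟨ε n⟩` there is a sequence of centers `⟨a n⟩` with `X ⊆ ⋃ n, B(a n, ε n)`. -/
def StrongMeasureZero (X : Set (ℕ → Bool)) : Prop :=
  ∀ ε : ℕ → ℝ, (∀ n, 0 < ε n) →
    ∃ a : ℕ → ℕ → Bool, X ⊆ ⋃ n, Metric.ball (a n) (ε n)

/-- A set `X ⊆ 2^ω` is *perfectly meager* if for every perfect set `P ⊆ 2^ω`
(nonempty, closed, without isolated points) the set `X ∩ P` is meager in the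
subspace topology of `P`. -/
def PerfectlyMeager (X : Set (ℕ → Bool)) : Prop :=
  ∀ P : Set (ℕ → Bool), Perfect P → P.Nonempty →
    IsMeagre {z : P | (z : ℕ → Bool) ∈ X}

open PiNat Set

/-- The tree of the set `P` splits at level `n` above the restriction of `x` to `n`. -/
def SplitsAt (P : Set (ℕ → Bool)) (x : ℕ → Bool) (n : ℕ) : Prop :=
  ∃ y ∈ P, ∃ z ∈ P, y ∈ cylinder x n ∧ z ∈ cylinder x n ∧ y n ≠ z n

/-- The sequence of values of `x` at the splitting levels of `P` along `x`. -/
noncomputable def splitCode (P : Set (ℕ → Bool)) (x : ℕ → Bool) (k : ℕ) : Bool :=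
  x (Nat.nth (SplitsAt P x) k)

section SplitCode

variable {P : Set (ℕ → Bool)} {x y : ℕ → Bool} {n k : ℕ}

theorem splitsAt_congr (h : y ∈ cylinder x n) : SplitsAt P y n ↔ SplitsAt P x n := by
  simp only [SplitsAt, mem_cylinder_iff_eq.1 h]

theorem count_splitsAt_congr [DecidablePred (SplitsAt P x)] [DecidablePred (SplitsAt P y)]
    (h : y ∈ cylinder x n) : Nat.count (SplitsAt P y) n = Nat.count (SplitsAt P x) n :=
  le_antisymm
    (Nat.count_mono_left fun _ hk => (splitsAt_congr (cylinder_anti x hk.le h)).1)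
    (Nat.count_mono_left fun _ hk => (splitsAt_congr (cylinder_anti x hk.le h)).2)

theorem infinite_splitsAt (hP : Preperfect P) (hx : x ∈ P) :
    (Set.ofPred (SplitsAt P x)).Infinite := by
  refine infinite_of_forall_exists_gt fun n => ?_
  obtain ⟨y, ⟨hy, hyP⟩, hne⟩ := preperfect_iff_nhds.1 hP x hx (cylinder x (n + 1))
    ((isOpen_cylinder _ x (n + 1)).mem_nhds (self_mem_cylinder x _))
  exact ⟨firstDiff y x, ⟨y, hyP, x, hx, mem_cylinder_firstDiff y x, self_mem_cylinder x _,
    apply_firstDiff_ne hne⟩, (mem_cylinder_iff_le_firstDiff hne (n + 1)).1 hy⟩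

theorem nth_splitsAt_congr (hx : (Set.ofPred (SplitsAt P x)).Infinite)
    (h : y ∈ cylinder x n) (hk : Nat.nth (SplitsAt P x) k ≤ n) :
    Nat.nth (SplitsAt P y) k = Nat.nth (SplitsAt P x) k := by
  classical
  have hy := cylinder_anti x hk h
  have hs : SplitsAt P y (Nat.nth (SplitsAt P x) k) :=
    (splitsAt_congr hy).2 (Nat.nth_mem_of_infinite hx k)
  have hc := Nat.nth_count hs
  rwa [count_splitsAt_congr hy, Nat.count_nth_of_infinite hx] at hc

theorem splitCode_congr (hx : (Set.ofPred (SplitsAt P x)).Infinite)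
    (h : y ∈ cylinder x n) (hk : Nat.nth (SplitsAt P x) k < n) :
    splitCode P y k = splitCode P x k := by
  rw [splitCode, nth_splitsAt_congr hx h hk.le, splitCode]
  exact h _ hk

theorem continuous_splitCode (hP : Preperfect P) :
    Continuous fun x : P => splitCode P x := by
  refine continuous_pi fun k => continuous_iff_continuousAt.2 fun x => ?_
  have hopen : IsOpen {y : P | (y : ℕ → Bool) ∈
      cylinder (x : ℕ → Bool) (Nat.nth (SplitsAt P x) k + 1)} :=
    (isOpen_cylinder _ _ _).preimage continuous_subtype_val
  refine (continuousAt_const (y := splitCode P x k)).congr ?_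
  filter_upwards [hopen.mem_nhds (self_mem_cylinder _ _)] with y hy
  exact (splitCode_congr (infinite_splitsAt hP x.2) hy (Nat.lt_succ_self _)).symm

/-- A point of `P` can be moved within `P`, without changing its first `n` values, so that its
code approximates any given `z` agreeing with it up to the number of splittings below `n`. -/
theorem exists_mem_cylinder_splitCode [DecidablePred (SplitsAt P x)] (hP : Preperfect P)
    (hx : x ∈ P) {z : ℕ → Bool}
    (hz : z ∈ cylinder (splitCode P x) (Nat.count (SplitsAt P x) n)) (m : ℕ) :
    ∃ y ∈ P, y ∈ cylinder x n ∧ splitCode P y ∈ cylinder z m := by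
  classical
  induction m with
  | zero => exact ⟨x, hx, self_mem_cylinder x n, by simp⟩
  | succ m ih =>
    obtain ⟨y, hyP, hyx, hyz⟩ := ih
    have hyinf := infinite_splitsAt hP hyP
    by_cases hm : splitCode P y m = z m
    · refine ⟨y, hyP, hyx, fun i hi => ?_⟩
      rcases Nat.lt_succ_iff_lt_or_eq.1 hi with hi | rfl
      exacts [hyz i hi, hm]
    set s := Nat.nth (SplitsAt P y) m with hs
    have hns : n ≤ s := by
      rw [hs, ← Nat.count_le_iff_le_nth hyinf, count_splitsAt_congr hyx]
      by_contra! hlt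
      have hxn := Nat.nth_lt_of_lt_count hlt
      exact hm ((splitCode_congr (infinite_splitsAt hP hx) hyx hxn).trans (hz m hlt).symm)
    obtain ⟨w, hwP, hwy, hws⟩ : ∃ w ∈ P, w ∈ cylinder y s ∧ w s ≠ y s := by
      obtain ⟨u, huP, v, hvP, hu, hv, huv⟩ := Nat.nth_mem_of_infinite hyinf m
      by_cases h : u s = y s
      · exact ⟨v, hvP, hv, fun h' => huv (h.trans h'.symm)⟩
      · exact ⟨u, huP, hu, h⟩
    refine ⟨w, hwP, ?_, fun i hi => ?_⟩
    · rw [← mem_cylinder_iff_eq.1 hyx]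
      exact cylinder_anti y hns hwy
    · rcases Nat.lt_succ_iff_lt_or_eq.1 hi with hi | rfl
      · exact (splitCode_congr hyinf hwy (Nat.nth_strictMono hyinf hi)).trans (hyz i hi)
      · rw [splitCode, nth_splitsAt_congr hyinf hwy le_rfl]
        rw [splitCode] at hm
        rw [Bool.eq_not_of_ne hws, Bool.eq_not_of_ne hm, Bool.not_not]

theorem isOpenMap_splitCode (hP : Perfect P) : IsOpenMap fun x : P => splitCode P x := by
  classical
  have : CompactSpace P := isCompact_iff_compactSpace.1 hP.closed.isCompact
  have hcont := continuous_splitCode hP.acc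
  rw [isOpenMap_iff_nhds_le]
  intro x U hU
  obtain ⟨V, hV, hVU⟩ := mem_nhds_subtype P x _ |>.1 hU
  obtain ⟨C, ⟨a, n, rfl⟩, hxC, hCV⟩ :=
    (isTopologicalBasis_cylinders fun _ : ℕ => Bool).mem_nhds_iff.1 hV
  rw [← mem_cylinder_iff_eq.1 hxC] at hCV
  refine Filter.mem_of_superset ((isOpen_cylinder _ (splitCode P x)
    (Nat.count (SplitsAt P x) n)).mem_nhds (self_mem_cylinder _ _)) fun z hz => ?_
  have hclosed : IsClosed ((fun y : P => splitCode P y) ''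
      {y : P | (y : ℕ → Bool) ∈ cylinder (x : ℕ → Bool) n}) :=
    hcont.isClosedMap _ (IsClosed.preimage continuous_subtype_val
      (cylinder_eq_pi (x : ℕ → Bool) n ▸ isClosed_set_pi fun _ _ => isClosed_singleton))
  have hmem : z ∈ (fun y : P => splitCode P y) ''
      {y : P | (y : ℕ → Bool) ∈ cylinder (x : ℕ → Bool) n} := by
    rw [← hclosed.closure_eq,
      (isTopologicalBasis_cylinders fun _ : ℕ => Bool).mem_closure_iff]
    rintro _ ⟨b, m, rfl⟩ hzb
    obtain ⟨y, hyP, hyx, hyz⟩ := exists_mem_cylinder_splitCode hP.acc x.2 hz m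
    rw [← mem_cylinder_iff_eq.1 hzb]
    exact ⟨_, hyz, ⟨y, hyP⟩, hyx, rfl⟩
  obtain ⟨y, hy, rfl⟩ := hmem
  exact hVU (hCV hy)

end SplitCode

theorem Continuous.exists_forall_dist_lt {α β : Type*} [PseudoMetricSpace α] [PseudoMetricSpace β]
    [CompactSpace α] {f : α → β} (hf : Continuous f) {ε : ℝ} (hε : 0 < ε) :
    ∃ δ > 0, ∀ a b, dist a b < δ → dist (f a) (f b) < ε := by
  obtain ⟨δ, hδ, h⟩ :=
    Metric.uniformContinuous_iff.1 (CompactSpace.uniformContinuous_of_continuous hf) ε hε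
  exact ⟨δ, hδ, fun a b => @h a b⟩

/-- The image of a strong measure zero set under a continuous function on a compact set has strong
measure zero. -/
theorem StrongMeasureZero.image_of_continuous {X P : Set (ℕ → Bool)}
    [CompactSpace P]
    (hX : StrongMeasureZero X) {f : P → ℕ → Bool} (hf : Continuous f) :
    StrongMeasureZero (f '' {z : P | (z : ℕ → Bool) ∈ X}) := by
  intro ε hε
  choose δ hδ hfδ using fun n => hf.exists_forall_dist_lt (hε n)
  obtain ⟨a, ha⟩ := hX (fun n => δ n / 2) fun n => half_pos (hδ n)
  have hb : ∀ n, ∃ b : ℕ → Bool, ∀ z : P, (z : ℕ → Bool) ∈ Metric.ball (a n) (δ n / 2) →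
      f z ∈ Metric.ball b (ε n) := by
    intro n
    by_cases h : ∃ w : P, (w : ℕ → Bool) ∈ Metric.ball (a n) (δ n / 2)
    · obtain ⟨w, hw⟩ := h
      refine ⟨f w, fun z hz => hfδ n z w ?_⟩
      rw [Subtype.dist_eq]
      calc dist (z : ℕ → Bool) w ≤ dist (z : ℕ → Bool) (a n) + dist (w : ℕ → Bool) (a n) :=
            dist_triangle_right _ _ _
        _ < δ n / 2 + δ n / 2 := add_lt_add hz hw
        _ = δ n := add_halves _
    · exact ⟨a n, fun z hz => (h ⟨z, hz⟩).elim⟩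
  choose b hb using hb
  refine ⟨b, ?_⟩
  rintro _ ⟨z, hz, rfl⟩
  obtain ⟨n, hn⟩ := mem_iUnion.1 (ha hz)
  exact mem_iUnion.2 ⟨n, hb n z hn⟩

/-- If every strong measure zero subset of `2^ω` is meager in `2^ω`, then every
strong measure zero subset of `2^ω` is perfectly meager. -/
theorem smz_perfectlyMeager
    (h : ∀ X : Set (ℕ → Bool), StrongMeasureZero X → IsMeagre X) :
    ∀ X : Set (ℕ → Bool), StrongMeasureZero X → PerfectlyMeager X := by
  intro X hX P hP _
  have : CompactSpace P := isCompact_iff_compactSpace.1 hP.closed.isCompact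
  have hcont := continuous_splitCode hP.acc
  exact ((h _ (hX.image_of_continuous hcont)).preimage_of_isOpenMap hcont (isOpenMap_splitCode hP)).mono
    (subset_preimage_image _ _)
end

section
/- If 𝔡 = 𝔠 and every subset of 2^ω of cardinality less than 𝔠 has strong measure zero, then there exists a subset of 2^ω of cardinality 𝔠 which has strong measure zero. -/
/-- The dominating number `𝔡`: the least cardinality of a family `D ⊆ ℕ^ℕ` such that
every `g : ℕ → ℕ` is eventually dominated by some member of `D`. -/
noncomputable def dominatingNumber : Cardinal :=
  sInf {c : Cardinal | ∃ D : Set (ℕ → ℕ), Cardinal.mk D = c ∧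
    ∀ g : ℕ → ℕ, ∃ f ∈ D, ∀ᶠ n in Filter.atTop, g n ≤ f n}

open Filter Cardinal

theorem exists_frequently_lt_of_mk_lt_dominatingNumber {D : Set (ℕ → ℕ)}
    (hD : #D < dominatingNumber) : ∃ g : ℕ → ℕ, ∀ f ∈ D, ∃ᶠ n in atTop, f n < g n := by
  by_contra! h
  refine hD.not_ge (csInf_le' ⟨D, rfl, fun g => ?_⟩)
  obtain ⟨f, hf, hfg⟩ := h g
  exact ⟨f, hf, hfg⟩

theorem finite_setOf_eq_false_from (n : ℕ) :
    {z : ℕ → Bool | ∀ m, n ≤ m → z m = false}.Finite := by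
  refine Set.Finite.of_finite_image
    (f := fun (z : ℕ → Bool) (i : Fin n) => z i) (Set.toFinite _) ?_
  intro z hz w hw hzw
  funext m
  by_cases hm : m < n
  · exact congrFun hzw ⟨m, hm⟩
  · rw [hz m (not_lt.1 hm), hw m (not_lt.1 hm)]

/-- The elements of `2^ω` with finite support. -/
def eventuallyFalse : Set (ℕ → Bool) :=
  ⋃ n, {z : ℕ → Bool | ∀ m, n ≤ m → z m = false}

theorem countable_eventuallyFalse : eventuallyFalse.Countable :=
  Set.countable_iUnion fun n => (finite_setOf_eq_false_from n).countable

/-- Points outside a neighbourhood of the finitely supported ones have uniformly bounded gaps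
in their supports. -/
theorem exists_monotone_gap_bound {U : Set (ℕ → Bool)} (hU : IsOpen U)
    (hUQ : eventuallyFalse ⊆ U) :
    ∃ f : ℕ → ℕ, Monotone f ∧
      ∀ x, x ∉ U → ∀ n, ∃ m, n ≤ m ∧ m < f n ∧ x m = true := by
  have hk : ∀ z : ℕ → Bool, ∃ k, z ∈ eventuallyFalse → PiNat.cylinder z k ⊆ U := by
    intro z
    by_cases hz : z ∈ eventuallyFalse
    · obtain ⟨ε, hε, hball⟩ := Metric.isOpen_iff.1 hU z (hUQ hz)
      obtain ⟨k, hk⟩ := exists_pow_lt_of_lt_one hε (by norm_num : (1 / 2 : ℝ) < 1)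
      exact ⟨k, fun _ y hy => hball ((PiNat.mem_cylinder_iff_dist_le.1 hy).trans_lt hk)⟩
    · exact ⟨0, fun h => absurd h hz⟩
  choose k hk using hk
  refine ⟨fun n => (finite_setOf_eq_false_from n).toFinset.sup k, fun a b hab => ?_,
    fun x hx n => ?_⟩
  · refine Finset.sup_mono fun z hz => ?_
    simp only [Set.Finite.mem_toFinset, Set.mem_ofPred_eq] at hz ⊢
    exact fun m hm => hz m (hab.trans hm)
  · set z : ℕ → Bool := fun m => if m < n then x m else false with hz
    have hzn : ∀ m, n ≤ m → z m = false := fun m hm => by simp [hz, not_lt.2 hm]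
    have hxz : x ∉ PiNat.cylinder z (k z) := fun h =>
      hx (hk z (Set.mem_iUnion.2 ⟨n, hzn⟩) h)
    simp only [PiNat.mem_cylinder_iff, not_forall] at hxz
    obtain ⟨m, hm, hne⟩ := hxz
    have hnm : n ≤ m := by
      by_contra! h
      simp [hz, h] at hne
    refine ⟨m, hnm, hm.trans_le (Finset.le_sup (f := k) (by simpa using hzn)), ?_⟩
    simpa [hzn m hnm] using hne

/-- The iteration bounding the enumeration of a set whose gaps are bounded by `f`. -/
def gapIterate (f : ℕ → ℕ) : ℕ → ℕ
  | 0 => f 0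
  | k + 1 => f (gapIterate f k + 1)

theorem StrictMono.le_gapIterate {g f : ℕ → ℕ} (hg : StrictMono g) (hf : Monotone f)
    (h : ∀ n, ∃ m, n ≤ m ∧ m < f n ∧ m ∈ Set.range g) (k : ℕ) : g k ≤ gapIterate f k := by
  induction k with
  | zero =>
    obtain ⟨_, -, hm, j, rfl⟩ := h 0
    exact (hg.monotone (Nat.zero_le j)).trans hm.le
  | succ k ih =>
    obtain ⟨_, hn, hm, j, rfl⟩ := h (g k + 1)
    exact (hg.monotone (hg.lt_iff_lt.1 hn)).trans (hm.le.trans (hf (Nat.succ_le_succ ih)))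

/-- A strictly increasing function above `g` that codes `y` in its parities. -/
def parityCode (g : ℕ → ℕ) (y : ℕ → Bool) (n : ℕ) : ℕ :=
  2 * (n + ∑ i ∈ Finset.range (n + 1), g i) + (y n).toNat

theorem strictMono_parityCode (g : ℕ → ℕ) (y : ℕ → Bool) : StrictMono (parityCode g y) := by
  refine strictMono_nat_of_lt_succ fun n => ?_
  have := Bool.toNat_le (y n)
  simp only [parityCode, Finset.sum_range_succ _ (n + 1)]
  omega

theorem le_parityCode (g : ℕ → ℕ) (y : ℕ → Bool) (n : ℕ) : g n ≤ parityCode g y n := by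
  simp only [parityCode, Finset.sum_range_succ]
  omega

theorem eq_of_parityCode_eq {g g' : ℕ → ℕ} {y y' : ℕ → Bool}
    (h : parityCode g y = parityCode g' y') : y = y' := by
  funext n
  have hn := congrFun h n
  simp only [parityCode] at hn
  cases hy : y n <;> cases hy' : y' n <;> simp [hy, hy'] at hn ⊢ <;> omega

/-- If `X` has a strong measure zero remainder outside every open set that includes a fixed
countable nonempty set, then `X` has strong measure zero. -/
theorem StrongMeasureZero.of_countable {X Q : Set (ℕ → Bool)} (hQ : Q.Countable)
    (hne : Q.Nonempty)
    (h : ∀ U, IsOpen U → Q ⊆ U → StrongMeasureZero (X \ U)) : StrongMeasureZero X := by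
  intro ε hε
  obtain ⟨q, rfl⟩ := hQ.exists_eq_range hne
  obtain ⟨a, ha⟩ := h (⋃ n, Metric.ball (q n) (ε (2 * n)))
    (isOpen_iUnion fun n => Metric.isOpen_ball)
    (Set.range_subset_iff.2 fun n =>
      Set.mem_iUnion.2 ⟨n, Metric.mem_ball_self (hε _)⟩)
    (fun n => ε (2 * n + 1)) (fun n => hε _)
  refine ⟨fun n => if n % 2 = 0 then q (n / 2) else a (n / 2), fun x hx => ?_⟩
  by_cases hxU : x ∈ ⋃ n, Metric.ball (q n) (ε (2 * n))
  · obtain ⟨n, hn⟩ := Set.mem_iUnion.1 hxU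
    exact Set.mem_iUnion.2 ⟨2 * n, by simpa using hn⟩
  · obtain ⟨n, hn⟩ := Set.mem_iUnion.1 (ha ⟨hx, hxU⟩)
    refine Set.mem_iUnion.2 ⟨2 * n + 1, ?_⟩
    have h1 : (2 * n + 1) % 2 = 1 := by omega
    have h2 : (2 * n + 1) / 2 = n := by omega
    simpa [h1, h2] using hn

/-- If `𝔡 = 𝔠` and every subset of `2^ω` of cardinality less than `𝔠` has strong
measure zero, then there is a strong measure zero subset of `2^ω` of cardinality `𝔠`. -/
theorem exists_smz_of_size_continuum
    (hd : dominatingNumber = Cardinal.continuum)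
    (hsmall : ∀ X : Set (ℕ → Bool), Cardinal.mk X < Cardinal.continuum →
      StrongMeasureZero X) :
    ∃ X : Set (ℕ → Bool), Cardinal.mk X = Cardinal.continuum ∧
      StrongMeasureZero X := by
  classical
  have hcard : #(ℕ → Bool) = continuum := by simp
  obtain ⟨e⟩ : Nonempty (continuum.{0}.ord.ToType ≃ (ℕ → Bool)) :=
    Cardinal.eq.1 (by rw [hcard, mk_ord_toType])
  obtain ⟨F⟩ : Nonempty (continuum.{0}.ord.ToType ≃ (ℕ → ℕ)) :=
    Cardinal.eq.1 (by rw [mk_ord_toType]; simp)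
  have hI (i : continuum.{0}.ord.ToType) : #(Set.Iio i) < continuum := by
    simpa using mk_Iio_lt i (by simp)
  have hg : ∀ i, ∃ g : ℕ → ℕ, ∀ j < i, ∃ᶠ n in atTop, F j n < g n := by
    intro i
    obtain ⟨g, hg⟩ := exists_frequently_lt_of_mk_lt_dominatingNumber
      (D := F '' Set.Iio i) (by rw [hd]; exact mk_image_le.trans_lt (hI i))
    exact ⟨g, fun j hj => hg _ ⟨j, hj, rfl⟩⟩
  choose g hg using hg
  let c i := parityCode (g i) (e i)
  have hc i : StrictMono (c i) := strictMono_parityCode _ _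
  let x i : ℕ → Bool := fun n => decide (n ∈ Set.range (c i))
  have hx : Function.Injective x := by
    intro i j hij
    have hr : Set.range (c i) = Set.range (c j) :=
      Set.ext fun n => decide_eq_decide.1 (congrFun hij n)
    exact e.injective (eq_of_parityCode_eq (((hc i).range_inj (hc j)).1 hr))
  refine ⟨Set.range x, by rw [mk_range_eq x hx, mk_ord_toType], ?_⟩
  refine StrongMeasureZero.of_countable countable_eventuallyFalse
    ⟨fun _ => false, Set.mem_iUnion.2 ⟨0, fun _ _ => rfl⟩⟩ fun U hU hUQ => hsmall _ ?_
  obtain ⟨f, hf, hfU⟩ := exists_monotone_gap_bound hU hUQ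
  obtain ⟨j, hj⟩ := F.surjective (gapIterate f)
  have hsub : Set.range x \ U ⊆ x '' Set.Iic j := by
    rintro _ ⟨⟨i, rfl⟩, hi⟩
    refine ⟨i, Set.mem_Iic.2 (le_of_not_gt fun hji => ?_), rfl⟩
    obtain ⟨n, hn⟩ := (hg i j hji).exists
    rw [hj] at hn
    have hle := (hc i).le_gapIterate hf (fun n => by simpa [x] using hfU _ hi n) n
    exact (hn.trans_le (le_parityCode (g i) (e i) n)).not_ge hle
  refine (mk_le_mk_of_subset hsub).trans_lt (mk_image_le.trans_lt ?_)
  rw [← Set.Iio_insert]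
  exact mk_insert_le.trans_lt (add_lt_of_lt aleph0_le_continuum (hI j)
    (one_lt_aleph0.trans_le aleph0_le_continuum))
end

section
/- Let A ⊆ ℕ be infinite and let Y ⊆ 2^ω be such that the restriction map y ↦ y↾A from Y to 2^A is =*-surjective, i.e., for every x : A → {0,1} there exists y ∈ Y with y(k) = x(k) for all but finitely many k ∈ A. Then there exists a countable family Φ of uniformly continuous maps from Y (with the metric inherited from the standard metric of 2^ω) to 2^ω such that 2^ω = ⋃_{φ∈Φ} φ[Y]. -/
/-- Reindexing a binary sequence along `e` and flipping the coordinates in `F` is continuous. -/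
theorem continuous_reindex_xor (e : ℕ → ℕ) (F : Finset ℕ) :
    Continuous fun (y : ℕ → Bool) (n : ℕ) => xor (y (e n)) (decide (n ∈ F)) :=
  continuous_pi fun n => (continuous_of_discreteTopology (f := fun b => xor b (decide (n ∈ F)))).comp
    (continuous_apply (e n))

/-- Let `A ⊆ ℕ` be infinite and let `Y ⊆ 2^ω` be such that the restriction map
`y ↦ y↾A` from `Y` to `2^A` is `=*`-surjective: for every `x : A → {0,1}` there is
`y ∈ Y` agreeing with `x` on all but finitely many elements of `A`. Then there is a
countable family `Φ` of uniformly continuous maps from `Y` to `2^ω` such that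
`2^ω = ⋃_{φ ∈ Φ} φ[Y]`. -/
theorem countable_unif_cont_covering
    (A : Set ℕ) (hA : A.Infinite) (Y : Set (ℕ → Bool))
    (hsurj : ∀ x : A → Bool, ∃ y ∈ Y, {k : A | y (k : ℕ) ≠ x k}.Finite) :
    ∃ Φ : Set (Y → (ℕ → Bool)), Φ.Countable ∧
      (∀ φ ∈ Φ, UniformContinuous φ) ∧
      ∀ z : ℕ → Bool, ∃ φ ∈ Φ, ∃ y : Y, φ y = z := by
  have : Infinite A := hA.to_subtype
  let e : ℕ ≃ A := (nonempty_equiv_of_countable (α := ℕ) (β := A)).some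
  refine ⟨Set.range fun (F : Finset ℕ) (y : Y) n => xor (y.1 (e n)) (decide (n ∈ F)),
    Set.countable_range _, ?_, fun z => ?_⟩
  · rintro _ ⟨F, rfl⟩
    exact (CompactSpace.uniformContinuous_of_continuous
      (continuous_reindex_xor (fun n => e n) F)).comp uniformContinuous_subtype_val
  · obtain ⟨y, hy, hfin⟩ := hsurj fun k => z (e.symm k)
    have hfin' : {n : ℕ | y (e n) ≠ z n}.Finite := by
      simpa [Set.preimage] using hfin.preimage e.injective.injOn
    refine ⟨_, ⟨hfin'.toFinset, rfl⟩, ⟨y, hy⟩, funext fun n => ?_⟩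
    by_cases h : y (e n) = z n
    · simp [h]
    · cases hz : z n <;> simp_all
end
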